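/- Let m, n ≥ 1. Any two existentially closed K_{m,n}-free incidence structures are elementarily equivalent in the language {P, L, I}. -/

import Mathlib

open FirstOrder FirstOrder.Language

universe u v

/-- Relation symbols of the language of incidence structures: two unary symbols
(`pt` for "point", `lin` for "line") and one binary symbol (`inc` for "incidence"). -/
inductive IncRel : ℕ → Type
  | pt : IncRel 1
  | lin : IncRel 1
  | inc : IncRel 2

/-- The first-order language `{P, L, I}` of incidence structures. -/
def IncLang : FirstOrder.Language := ⟨fun _ => Empty, IncRel⟩

section
variable {M : Type u} [IncLang.Structure M]

/-- `x` is a point. -/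
def ptL (x : M) : Prop := Structure.RelMap (L := IncLang) IncRel.pt ![x]

/-- `x` is a line. -/
def lnL (x : M) : Prop := Structure.RelMap (L := IncLang) IncRel.lin ![x]

/-- `x` is incident to `y`. -/
def incL (x y : M) : Prop := Structure.RelMap (L := IncLang) IncRel.inc ![x, y]

end

/-- `M` is an incidence structure: points and lines partition the domain, and
incidence only holds between a point and a line. -/
def IsIncidenceL (M : Type u) [IncLang.Structure M] : Prop :=
  (∀ x : M, ptL x ∨ lnL x) ∧ (∀ x : M, ¬(ptL x ∧ lnL x)) ∧
    ∀ x y : M, incL x y → ptL x ∧ lnL y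

/-- `M` is `K_{m,n}`-free: there are no `m` pairwise distinct points and `n` pairwise
distinct lines with every one of the points incident to every one of the lines. -/
def KFreeL (m n : ℕ) (M : Type u) [IncLang.Structure M] : Prop :=
  ¬∃ (a : Fin m → M) (b : Fin n → M),
      Function.Injective a ∧ Function.Injective b ∧
      (∀ i, ptL (a i)) ∧ (∀ j, lnL (b j)) ∧ ∀ i j, incL (a i) (b j)

/-- `M` is an existentially closed `K_{m,n}`-free incidence structure: `M` is a
`K_{m,n}`-free incidence structure, and for every `K_{m,n}`-free incidence structure
`N` containing `M` as an induced substructure (i.e. admitting an embedding of `M`),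
every existential formula `∃ ȳ φ(ā, ȳ)` (with `φ` quantifier-free and parameters `ā`
from `M`) that holds in `N` also holds in `M`. -/
def IsECL (m n : ℕ) (M : Type u) [IncLang.Structure M] : Prop :=
  IsIncidenceL M ∧ KFreeL m n M ∧
    ∀ (N : Type u) [IncLang.Structure N], IsIncidenceL N → KFreeL m n N →
      ∀ (f : M ↪[IncLang] N) (k : ℕ) (φ : IncLang.BoundedFormula M k), φ.IsQF →
        (∃ xs : Fin k → N, φ.Realize (f : M → N) xs) →
          ∃ xs : Fin k → M, φ.Realize (id : M → M) xs


/-- Two families of elements have the same quantifier-free type. -/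
def Sim {T : Type*} {A : Type*} {B : Type*} [IncLang.Structure A] [IncLang.Structure B]
    (p : T → A) (q : T → B) : Prop :=
  ∀ s t, (p s = p t ↔ q s = q t) ∧ (ptL (p s) ↔ ptL (q s)) ∧ (lnL (p s) ↔ lnL (q s)) ∧
    (incL (p s) (p t) ↔ incL (q s) (q t))

/-- Structure from explicit relations. -/
@[reducible]
def mkStr {A : Type*} (pt ln : A → Prop) (inc : A → A → Prop) : IncLang.Structure A where
  funMap := fun f => Empty.elim f
  RelMap := fun {_} r => match r with
    | IncRel.pt => fun xs => pt (xs 0)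
    | IncRel.lin => fun xs => ln (xs 0)
    | IncRel.inc => fun xs => inc (xs 0) (xs 1)

section
variable {A : Type*} {B : Type*} [IncLang.Structure A] [IncLang.Structure B]

theorem relMap_pt (x : Fin 1 → A) :
    Structure.RelMap (L := IncLang) IncRel.pt x ↔ ptL (x 0) := by
  unfold ptL
  rw [show ![x 0] = x from by ext i; fin_cases i; rfl]

theorem relMap_lin (x : Fin 1 → A) :
    Structure.RelMap (L := IncLang) IncRel.lin x ↔ lnL (x 0) := by
  unfold lnL
  rw [show ![x 0] = x from by ext i; fin_cases i; rfl]

theorem relMap_inc (x : Fin 2 → A) :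
    Structure.RelMap (L := IncLang) IncRel.inc x ↔ incL (x 0) (x 1) := by
  unfold incL
  rw [show ![x 0, x 1] = x from by ext i; fin_cases i <;> rfl]

/-- Embedding from a similarity. -/
def Sim.emb {g : A → B} (h : Sim id g) : A ↪[IncLang] B where
  toFun := g
  inj' := fun x y hxy => (h x y).1.2 hxy
  map_fun' := fun f => Empty.elim f
  map_rel' := fun {k} r x => by
    cases r with
    | pt => rw [relMap_pt, relMap_pt]; exact (h _ (x 0)).2.1.symm
    | lin => rw [relMap_lin, relMap_lin]; exact (h _ (x 0)).2.2.1.symm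
    | inc => rw [relMap_inc, relMap_inc]; exact (h _ _).2.2.2.symm

theorem emb_pt (f : A ↪[IncLang] B) (x : A) : ptL (f x) ↔ ptL x := by
  have := f.map_rel IncRel.pt ![x]
  rwa [relMap_pt, relMap_pt] at this

theorem emb_ln (f : A ↪[IncLang] B) (x : A) : lnL (f x) ↔ lnL x := by
  have := f.map_rel IncRel.lin ![x]
  rwa [relMap_lin, relMap_lin] at this

theorem emb_inc (f : A ↪[IncLang] B) (x y : A) : incL (f x) (f y) ↔ incL x y := by
  have := f.map_rel IncRel.inc ![x, y]
  rwa [relMap_inc, relMap_inc] at this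

end

theorem isQF_foldr {α : Type*} {k : ℕ} (l : List (IncLang.BoundedFormula α k))
    (h : ∀ φ ∈ l, φ.IsQF) : (l.foldr (· ⊓ ·) ⊤).IsQF := by
  induction l with
  | nil => exact BoundedFormula.IsQF.top
  | cons a l ih =>
    exact (h a (by simp)).inf (ih fun φ hφ => h φ (by simp [hφ]))

theorem ec_family {m n : ℕ} {M : Type u} [IncLang.Structure M] (hM : IsECL m n M)
    {N : Type u} [IncLang.Structure N] (hN : IsIncidenceL N) (hK : KFreeL m n N)
    (f : M ↪[IncLang] N) (k : ℕ) (xs : Fin k → N) (l : List (IncLang.BoundedFormula M k))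
    (hl : ∀ φ ∈ l, φ.IsQF) :
    ∃ ys : Fin k → M, ∀ φ ∈ l, (φ.Realize (f : M → N) xs ↔ φ.Realize (id : M → M) ys) := by
  classical
  let lit : IncLang.BoundedFormula M k → IncLang.BoundedFormula M k :=
    fun φ => if φ.Realize (f : M → N) xs then φ else φ.not
  obtain ⟨ys, hys⟩ := hM.2.2 N hN hK f k ((l.map lit).foldr (· ⊓ ·) ⊤)
    (isQF_foldr _ (by
      intro φ hφ
      obtain ⟨ψ, hψ, rfl⟩ := List.mem_map.1 hφ
      simp only [lit]
      split_ifs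
      · exact hl ψ hψ
      · exact (hl ψ hψ).not))
    ⟨xs, by
      rw [BoundedFormula.realize_foldr_inf]
      intro φ hφ
      obtain ⟨ψ, hψ, rfl⟩ := List.mem_map.1 hφ
      simp only [lit]
      split_ifs with h
      · exact h
      · exact h⟩
  refine ⟨ys, fun φ hφ => ?_⟩
  rw [BoundedFormula.realize_foldr_inf] at hys
  have := hys _ (List.mem_map.2 ⟨φ, hφ, rfl⟩)
  simp only [lit] at this
  split_ifs at this with h
  · exact ⟨fun _ => this, fun _ => h⟩
  · exact ⟨fun h' => absurd h' h, fun h' => absurd h' this⟩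

theorem ec_sim {m n : ℕ} {M : Type u} [IncLang.Structure M] (hM : IsECL m n M)
    {N : Type u} [IncLang.Structure N] (hN : IsIncidenceL N) (hK : KFreeL m n N)
    (f : M ↪[IncLang] N) (k : ℕ) (xs : Fin k → N) {T : Type*} [Finite T] (τ : T → M ⊕ Fin k) :
    ∃ ys : Fin k → M,
      Sim (fun t => Sum.elim (f : M → N) xs (τ t)) (fun t => Sum.elim id ys (τ t)) := by
  classical
  have := Fintype.ofFinite T
  let tm : T → IncLang.Term (M ⊕ Fin k) := fun t => Term.var (τ t)
  let fam : Fin 4 × T × T → IncLang.BoundedFormula M k := fun x =>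
    match x with
    | (0, s, t) => BoundedFormula.equal (tm s) (tm t)
    | (1, s, _) => BoundedFormula.rel (L := IncLang) (l := 1) IncRel.pt (fun _ => tm s)
    | (2, s, _) => BoundedFormula.rel (L := IncLang) (l := 1) IncRel.lin (fun _ => tm s)
    | (3, s, t) => BoundedFormula.rel (L := IncLang) (l := 2) IncRel.inc ![tm s, tm t]
  obtain ⟨ys, hys⟩ := ec_family hM hN hK f k xs ((Finset.univ : Finset (Fin 4 × T × T)).toList.map fam)
    (by
      intro φ hφ
      obtain ⟨⟨i, s, t⟩, -, rfl⟩ := List.mem_map.1 hφ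
      apply BoundedFormula.IsAtomic.isQF
      fin_cases i
      · exact BoundedFormula.IsAtomic.equal _ _
      · exact BoundedFormula.IsAtomic.rel _ _
      · exact BoundedFormula.IsAtomic.rel _ _
      · exact BoundedFormula.IsAtomic.rel _ _)
  refine ⟨ys, fun s t => ?_⟩
  have h : ∀ i, _ := fun i => hys (fam (i, s, t)) (List.mem_map.2 ⟨(i, s, t), by simp, rfl⟩)
  refine ⟨h 0, ?_, ?_, ?_⟩
  · have := h 1
    simp only [fam, BoundedFormula.Realize] at this
    rw [relMap_pt, relMap_pt] at this
    exact this
  · have := h 2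
    simp only [fam, BoundedFormula.Realize] at this
    rw [relMap_lin, relMap_lin] at this
    exact this
  · have := h 3
    simp only [fam, BoundedFormula.Realize] at this
    rw [relMap_inc, relMap_inc] at this
    exact this

/-- The first-order axioms satisfied by existentially closed structures. -/
structure GoodL (m n : ℕ) (M : Type u) [IncLang.Structure M] : Prop where
  ne : Nonempty M
  incd : IsIncidenceL M
  free : KFreeL m n M
  lines : ∀ a : Fin m → M, Function.Injective a → (∀ i, ptL (a i)) →
    ∃ b : Fin (n - 1) → M, Function.Injective b ∧ (∀ j, lnL (b j)) ∧ ∀ i j, incL (a i) (b j)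
  points : ∀ b : Fin n → M, Function.Injective b → (∀ i, lnL (b i)) →
    ∃ a : Fin (m - 1) → M, Function.Injective a ∧ (∀ j, ptL (a j)) ∧ ∀ i j, incL (a i) (b j)
  ext : ∀ (B : Type) [Finite B] [IncLang.Structure B], IsIncidenceL B → KFreeL m n B →
    ∀ (S : Set B) (a : S → M), Sim (Subtype.val : S → B) a →
    (∀ x ∉ S, ¬∃ l : Fin n → B, Function.Injective l ∧ (∀ j, l j ∈ S) ∧ ∀ j, incL x (l j)) →
    (∀ x ∉ S, ¬∃ p : Fin m → B, Function.Injective p ∧ (∀ j, p j ∈ S) ∧ ∀ j, incL (p j) x) →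
    ∃ g : B → M, Sim id g ∧ ∀ s : S, g s = a s

theorem ec_nonempty {m n : ℕ} (hn : 1 ≤ n) {M : Type u} [IncLang.Structure M]
    (hM : IsECL m n M) : Nonempty M := by
  by_contra hne
  rw [not_nonempty_iff] at hne
  let _ : IncLang.Structure PUnit.{u + 1} := mkStr (fun _ => True) (fun _ => False)
    (fun _ _ => False)
  have h1 : IsIncidenceL PUnit.{u + 1} :=
    ⟨fun _ => Or.inl trivial, fun _ h => h.2, fun _ _ h => h.elim⟩
  have h2 : KFreeL m n PUnit.{u + 1} := by
    rintro ⟨a, b, -, -, -, hb, -⟩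
    exact hb ⟨0, hn⟩
  have h3 : Sim (id : M → M) (fun x => (hne.elim x : PUnit.{u + 1})) := fun x => hne.elim x
  obtain ⟨ys, -⟩ := ec_sim hM h1 h2 h3.emb 1 (fun _ => PUnit.unit)
    (fun x : Empty => (Empty.elim x : M ⊕ Fin 1))
  exact hne.elim (ys 0)

theorem ec_lines {m n : ℕ} (hn : 1 ≤ n) {M : Type u} [IncLang.Structure M]
    (hM : IsECL m n M) (a : Fin m → M) (ha : Function.Injective a) (hpa : ∀ i, ptL (a i)) :
    ∃ b : Fin (n - 1) → M, Function.Injective b ∧ (∀ j, lnL (b j)) ∧ ∀ i j, incL (a i) (b j) := by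
  by_contra hcon
  obtain ⟨n, rfl⟩ : ∃ n', n = n' + 1 := ⟨n - 1, by omega⟩
  let _ : IncLang.Structure (Option M) := mkStr (fun o => ∃ x, o = some x ∧ ptL x)
    (fun o => o = none ∨ ∃ x, o = some x ∧ lnL x)
    (fun o o' => ∃ x, o = some x ∧ ((o' = none ∧ ∃ i, a i = x) ∨ ∃ y, o' = some y ∧ incL x y))
  have ept : ∀ o : Option M, ptL o ↔ ∃ x, o = some x ∧ ptL x := fun _ => Iff.rfl
  have eln : ∀ o : Option M, lnL o ↔ (o = none ∨ ∃ x, o = some x ∧ lnL x) := fun _ => Iff.rfl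
  have einc : ∀ o o' : Option M, incL o o' ↔ ∃ x, o = some x ∧
    ((o' = none ∧ ∃ i, a i = x) ∨ ∃ y, o' = some y ∧ incL x y) := fun _ _ => Iff.rfl
  obtain ⟨⟨hM1, hM2, hM3⟩, hMK, -⟩ := id hM
  have h1 : IsIncidenceL (Option M) := by
    refine ⟨?_, ?_, ?_⟩
    · rintro (_ | x)
      · right; simp [eln]
      · rcases hM1 x with h | h
        · left; simp [ept, h]
        · right; simp [eln, h]
    · rintro (_ | x) ⟨h, h'⟩
      · simp [ept] at h
      · simp [ept] at h; simp [eln] at h'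
        exact hM2 x ⟨h, h'⟩
    · intro o o' h
      obtain ⟨x, rfl, ⟨rfl, i, rfl⟩ | ⟨y, rfl, hh⟩⟩ := (einc _ _).1 h
      · simp [ept, eln, hpa]
      · simp [ept, eln, hM3 x y hh]
  have h2 : KFreeL m (n + 1) (Option M) := by
    rintro ⟨p, l, hp, hl, hpp, hll, hpl⟩
    choose p' hp' hpp' using fun i => (ept _).1 (hpp i)
    have hp'i : Function.Injective p' := fun i j h => hp (by rw [hp', hp', h])
    by_cases hj : ∃ j0, l j0 = none
    · obtain ⟨j0, hj0⟩ := hj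
      have hex : ∀ i, ∃ i', a i' = p' i := by
        intro i
        obtain ⟨x, hx, ⟨-, h⟩ | ⟨y, hy, -⟩⟩ := (einc _ _).1 (hpl i j0)
        · rw [hp'] at hx; cases hx; exact h
        · rw [hj0] at hy; cases hy
      choose σ hσ using hex
      have hσi : Function.Injective σ := fun i j h => hp'i (by rw [← hσ, ← hσ, h])
      have hσs : Function.Surjective σ := Finite.surjective_of_injective hσi
      have hl' : ∀ j, ∃ y, l (j0.succAbove j) = some y := by
        intro j
        rcases h : l (j0.succAbove j) with _ | y
        · exact absurd (hl (h.trans hj0.symm)) (Fin.succAbove_ne _ _)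
        · exact ⟨y, rfl⟩
      choose l' hl' using hl'
      refine hcon ⟨l', fun i j h => ?_, fun j => ?_, fun i j => ?_⟩
      · exact Fin.succAbove_right_injective (hl (by rw [hl', hl', h]))
      · have := hll (j0.succAbove j)
        rw [hl', eln] at this
        simpa using this
      · obtain ⟨i, rfl⟩ := hσs i
        have := hpl i (j0.succAbove j)
        rw [hl', hp', einc] at this
        rw [hσ]
        simpa using this
    · have hl' : ∀ j, ∃ y, l j = some y := by
        intro j
        rcases h : l j with _ | y
        · exact absurd ⟨j, h⟩ hj
        · exact ⟨y, rfl⟩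
      choose l' hl' using hl'
      refine hMK ⟨p', l', hp'i, fun i j h => hl (by rw [hl', hl', h]), hpp', fun j => ?_,
        fun i j => ?_⟩
      · have := hll j
        rw [hl', eln] at this
        simpa using this
      · have := hpl i j
        rw [hl', hp', einc] at this
        simpa using this
  have h3 : Sim (id : M → M) (some : M → Option M) := by
    intro x y
    simp [ept, eln, einc]
  have key : ∀ j : ℕ, ∃ b : Fin j → M, Function.Injective b ∧ (∀ i, lnL (b i)) ∧
      ∀ i i', incL (a i) (b i') := by
    intro j
    induction j with
    | zero => exact ⟨Fin.elim0, fun i => i.elim0, fun i => i.elim0, fun _ i => i.elim0⟩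
    | succ j ih =>
      obtain ⟨b, hb1, hb2, hb3⟩ := ih
      obtain ⟨ys, hys⟩ := ec_sim hM h1 h2 h3.emb 1 (fun _ => none)
        (T := Fin m ⊕ Fin j ⊕ Unit)
        (Sum.elim (fun i => Sum.inl (a i)) (Sum.elim (fun i => Sum.inl (b i)) fun _ => Sum.inr 0))
      have hln : lnL (ys 0) := by
        have := (hys (Sum.inr (Sum.inr ())) (Sum.inr (Sum.inr ()))).2.2.1
        exact this.1 (Or.inl rfl)
      have hinc : ∀ i, incL (a i) (ys 0) := by
        intro i
        have := (hys (Sum.inl i) (Sum.inr (Sum.inr ()))).2.2.2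
        exact this.1 ⟨a i, rfl, Or.inl ⟨rfl, i, rfl⟩⟩
      have hne : ∀ i, b i ≠ ys 0 := by
        intro i h
        have := (hys (Sum.inr (Sum.inl i)) (Sum.inr (Sum.inr ()))).1
        have h' : some (b i) = none := this.2 h
        cases h'
      refine ⟨Fin.cons (ys 0) b, ?_, ?_, ?_⟩
      · rw [Fin.cons_injective_iff]
        exact ⟨fun ⟨i, hi⟩ => hne i hi, hb1⟩
      · intro i
        refine Fin.cases ?_ (fun i => ?_) i
        · simpa using hln
        · simpa using hb2 i
      · intro i i'
        refine Fin.cases ?_ (fun i' => ?_) i'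
        · simpa using hinc i
        · simpa using hb3 i i'
  exact hcon (key n)

theorem ec_points {m n : ℕ} (hm : 1 ≤ m) {M : Type u} [IncLang.Structure M]
    (hM : IsECL m n M) (a : Fin n → M) (ha : Function.Injective a) (hpa : ∀ i, lnL (a i)) :
    ∃ b : Fin (m - 1) → M, Function.Injective b ∧ (∀ j, ptL (b j)) ∧ ∀ j i, incL (b j) (a i) := by
  by_contra hcon
  obtain ⟨m, rfl⟩ : ∃ m', m = m' + 1 := ⟨m - 1, by omega⟩
  let _ : IncLang.Structure (Option M) := mkStr (fun o => o = none ∨ ∃ x, o = some x ∧ ptL x)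
    (fun o => ∃ x, o = some x ∧ lnL x)
    (fun o' o => ∃ x, o = some x ∧ ((o' = none ∧ ∃ i, a i = x) ∨ ∃ y, o' = some y ∧ incL y x))
  have eln : ∀ o : Option M, lnL o ↔ ∃ x, o = some x ∧ lnL x := fun _ => Iff.rfl
  have ept : ∀ o : Option M, ptL o ↔ (o = none ∨ ∃ x, o = some x ∧ ptL x) := fun _ => Iff.rfl
  have einc : ∀ o' o : Option M, incL o' o ↔ ∃ x, o = some x ∧
    ((o' = none ∧ ∃ i, a i = x) ∨ ∃ y, o' = some y ∧ incL y x) := fun _ _ => Iff.rfl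
  obtain ⟨⟨hM1, hM2, hM3⟩, hMK, -⟩ := id hM
  have h1 : IsIncidenceL (Option M) := by
    refine ⟨?_, ?_, ?_⟩
    · rintro (_ | x)
      · left; simp [ept]
      · rcases hM1 x with h | h
        · left; simp [ept, h]
        · right; simp [eln, h]
    · rintro (_ | x) ⟨h', h⟩
      · simp [eln] at h
      · simp [eln] at h; simp [ept] at h'
        exact hM2 x ⟨h', h⟩
    · intro o' o h
      obtain ⟨x, rfl, ⟨rfl, i, rfl⟩ | ⟨y, rfl, hh⟩⟩ := (einc _ _).1 h
      · simp [ept, eln, hpa]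
      · simp [ept, eln, hM3 y x hh]
  have h2 : KFreeL (m + 1) n (Option M) := by
    rintro ⟨l, p, hl, hp, hll, hpp, hlp⟩
    choose p' hp' hpp' using fun i => (eln _).1 (hpp i)
    have hp'i : Function.Injective p' := fun i j h => hp (by rw [hp', hp', h])
    by_cases hj : ∃ j0, l j0 = none
    · obtain ⟨j0, hj0⟩ := hj
      have hex : ∀ i, ∃ i', a i' = p' i := by
        intro i
        obtain ⟨x, hx, ⟨-, h⟩ | ⟨y, hy, -⟩⟩ := (einc _ _).1 (hlp j0 i)
        · rw [hp'] at hx; cases hx; exact h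
        · rw [hj0] at hy; cases hy
      choose σ hσ using hex
      have hσi : Function.Injective σ := fun i j h => hp'i (by rw [← hσ, ← hσ, h])
      have hσs : Function.Surjective σ := Finite.surjective_of_injective hσi
      have hl' : ∀ j, ∃ y, l (j0.succAbove j) = some y := by
        intro j
        rcases h : l (j0.succAbove j) with _ | y
        · exact absurd (hl (h.trans hj0.symm)) (Fin.succAbove_ne _ _)
        · exact ⟨y, rfl⟩
      choose l' hl' using hl'
      refine hcon ⟨l', fun i j h => ?_, fun j => ?_, fun j i => ?_⟩
      · exact Fin.succAbove_right_injective (hl (by rw [hl', hl', h]))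
      · have := hll (j0.succAbove j)
        rw [hl', ept] at this
        simpa using this
      · obtain ⟨i, rfl⟩ := hσs i
        have := hlp (j0.succAbove j) i
        rw [hl', hp', einc] at this
        rw [hσ]
        simpa using this
    · have hl' : ∀ j, ∃ y, l j = some y := by
        intro j
        rcases h : l j with _ | y
        · exact absurd ⟨j, h⟩ hj
        · exact ⟨y, rfl⟩
      choose l' hl' using hl'
      refine hMK ⟨l', p', fun i j h => hl (by rw [hl', hl', h]), hp'i, fun j => ?_, hpp',
        fun j i => ?_⟩
      · have := hll j
        rw [hl', ept] at this
        simpa using this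
      · have := hlp j i
        rw [hl', hp', einc] at this
        simpa using this
  have h3 : Sim (id : M → M) (some : M → Option M) := by
    intro x y
    simp [ept, eln, einc]
  have key : ∀ j : ℕ, ∃ b : Fin j → M, Function.Injective b ∧ (∀ i, ptL (b i)) ∧
      ∀ i' i, incL (b i') (a i) := by
    intro j
    induction j with
    | zero => exact ⟨Fin.elim0, fun i => i.elim0, fun i => i.elim0, fun i => i.elim0⟩
    | succ j ih =>
      obtain ⟨b, hb1, hb2, hb3⟩ := ih
      obtain ⟨ys, hys⟩ := ec_sim hM h1 h2 h3.emb 1 (fun _ => none)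
        (T := Fin n ⊕ Fin j ⊕ Unit)
        (Sum.elim (fun i => Sum.inl (a i)) (Sum.elim (fun i => Sum.inl (b i)) fun _ => Sum.inr 0))
      have hln : ptL (ys 0) := by
        have := (hys (Sum.inr (Sum.inr ())) (Sum.inr (Sum.inr ()))).2.1
        exact this.1 (Or.inl rfl)
      have hinc : ∀ i, incL (ys 0) (a i) := by
        intro i
        have := (hys (Sum.inr (Sum.inr ())) (Sum.inl i)).2.2.2
        exact this.1 ⟨a i, rfl, Or.inl ⟨rfl, i, rfl⟩⟩
      have hne : ∀ i, b i ≠ ys 0 := by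
        intro i h
        have := (hys (Sum.inr (Sum.inl i)) (Sum.inr (Sum.inr ()))).1
        have h' : some (b i) = none := this.2 h
        cases h'
      refine ⟨Fin.cons (ys 0) b, ?_, ?_, ?_⟩
      · rw [Fin.cons_injective_iff]
        exact ⟨fun ⟨i, hi⟩ => hne i hi, hb1⟩
      · intro i
        refine Fin.cases ?_ (fun i => ?_) i
        · simpa using hln
        · simpa using hb2 i
      · intro i' i
        refine Fin.cases ?_ (fun i' => ?_) i'
        · simpa using hinc i
        · simpa using hb3 i' i
  exact hcon (key m)

theorem ec_ext {m n : ℕ} (hm : 1 ≤ m) (hn : 1 ≤ n) {M : Type u} [IncLang.Structure M]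
    (hM : IsECL m n M) (B : Type) [Finite B] [IncLang.Structure B]
    (hB : IsIncidenceL B) (hBK : KFreeL m n B)
    (S : Set B) (a : S → M) (ha : Sim (Subtype.val : S → B) a)
    (hS1 : ∀ x ∉ S, ¬∃ l : Fin n → B, Function.Injective l ∧ (∀ j, l j ∈ S) ∧ ∀ j, incL x (l j))
    (hS2 : ∀ x ∉ S, ¬∃ p : Fin m → B, Function.Injective p ∧ (∀ j, p j ∈ S) ∧
      ∀ j, incL (p j) x) :
    ∃ g : B → M, Sim id g ∧ ∀ s : S, g s = a s := by
  classical
  let N : Type u := M ⊕ {x : B // x ∉ S}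
  let c : B → N := fun x => if h : x ∈ S then Sum.inl (a ⟨x, h⟩) else Sum.inr ⟨x, h⟩
  have cS : ∀ x (h : x ∈ S), c x = Sum.inl (a ⟨x, h⟩) := fun x h => by simp [c, h]
  have cn : ∀ x (h : x ∉ S), c x = Sum.inr ⟨x, h⟩ := fun x h => by simp [c, h]
  have cinj : Function.Injective c := by
    intro x y hxy
    by_cases hx : x ∈ S <;> by_cases hy : y ∈ S
    · rw [cS x hx, cS y hy] at hxy
      exact (ha ⟨x, hx⟩ ⟨y, hy⟩).1.2 (Sum.inl_injective hxy)
    · rw [cS x hx, cn y hy] at hxy; cases hxy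
    · rw [cn x hx, cS y hy] at hxy; cases hxy
    · rw [cn x hx, cn y hy] at hxy
      cases hxy; rfl
  have cinl : ∀ x z, c x = Sum.inl z → ∃ h : x ∈ S, a ⟨x, h⟩ = z := by
    intro x z h
    by_cases hx : x ∈ S
    · rw [cS x hx] at h
      exact ⟨hx, Sum.inl_injective h⟩
    · rw [cn x hx] at h; cases h
  let _ : IncLang.Structure N := mkStr
    (fun u => (∃ x, u = Sum.inl x ∧ ptL x) ∨ ∃ x, u = c x ∧ ptL x)
    (fun u => (∃ x, u = Sum.inl x ∧ lnL x) ∨ ∃ x, u = c x ∧ lnL x)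
    (fun u v => (∃ x y, u = Sum.inl x ∧ v = Sum.inl y ∧ incL x y) ∨
      ∃ x y, u = c x ∧ v = c y ∧ incL x y)
  have ept : ∀ u : N, ptL u ↔ ((∃ x, u = Sum.inl x ∧ ptL x) ∨ ∃ x, u = c x ∧ ptL x) :=
    fun _ => Iff.rfl
  have eln : ∀ u : N, lnL u ↔ ((∃ x, u = Sum.inl x ∧ lnL x) ∨ ∃ x, u = c x ∧ lnL x) :=
    fun _ => Iff.rfl
  have einc : ∀ u v : N, incL u v ↔ ((∃ x y, u = Sum.inl x ∧ v = Sum.inl y ∧ incL x y) ∨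
      ∃ x y, u = c x ∧ v = c y ∧ incL x y) := fun _ _ => Iff.rfl
  have simM : Sim (id : M → M) (Sum.inl : M → N) := by
    intro x y
    refine ⟨?_, ?_, ?_, ?_⟩
    · exact Sum.inl_injective.eq_iff.symm
    · rw [ept]
      constructor
      · intro h; exact Or.inl ⟨x, rfl, h⟩
      · rintro (⟨x', h, h'⟩ | ⟨x', h, h'⟩)
        · cases h; exact h'
        · obtain ⟨hx, rfl⟩ := cinl _ _ h.symm
          exact (ha ⟨x', hx⟩ ⟨x', hx⟩).2.1.1 h'
    · rw [eln]
      constructor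
      · intro h; exact Or.inl ⟨x, rfl, h⟩
      · rintro (⟨x', h, h'⟩ | ⟨x', h, h'⟩)
        · cases h; exact h'
        · obtain ⟨hx, rfl⟩ := cinl _ _ h.symm
          exact (ha ⟨x', hx⟩ ⟨x', hx⟩).2.2.1.1 h'
    · rw [einc]
      constructor
      · intro h; exact Or.inl ⟨x, y, rfl, rfl, h⟩
      · rintro (⟨x', y', h, h1, h'⟩ | ⟨x', y', h, h1, h'⟩)
        · cases h; cases h1; exact h'
        · obtain ⟨hx, rfl⟩ := cinl _ _ h.symm
          obtain ⟨hy, rfl⟩ := cinl _ _ h1.symm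
          exact (ha ⟨x', hx⟩ ⟨y', hy⟩).2.2.2.1 h'
  have simB : Sim (id : B → B) c := by
    intro x y
    refine ⟨?_, ?_, ?_, ?_⟩
    · exact cinj.eq_iff.symm
    · rw [ept]
      constructor
      · intro h; exact Or.inr ⟨x, rfl, h⟩
      · rintro (⟨x', h, h'⟩ | ⟨x', h, h'⟩)
        · obtain ⟨hx, rfl⟩ := cinl _ _ h
          exact (ha ⟨x, hx⟩ ⟨x, hx⟩).2.1.2 h'
        · cases cinj h; exact h'
    · rw [eln]
      constructor
      · intro h; exact Or.inr ⟨x, rfl, h⟩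
      · rintro (⟨x', h, h'⟩ | ⟨x', h, h'⟩)
        · obtain ⟨hx, rfl⟩ := cinl _ _ h
          exact (ha ⟨x, hx⟩ ⟨x, hx⟩).2.2.1.2 h'
        · cases cinj h; exact h'
    · rw [einc]
      constructor
      · intro h; exact Or.inr ⟨x, y, rfl, rfl, h⟩
      · rintro (⟨x', y', h, h1, h'⟩ | ⟨x', y', h, h1, h'⟩)
        · obtain ⟨hx, rfl⟩ := cinl _ _ h
          obtain ⟨hy, rfl⟩ := cinl _ _ h1
          exact (ha ⟨x, hx⟩ ⟨y, hy⟩).2.2.2.2 h'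
        · cases cinj h; cases cinj h1; exact h'
  obtain ⟨⟨hM1, hM2, hM3⟩, hMK, -⟩ := id hM
  obtain ⟨hB1, hB2, hB3⟩ := id hB
  have cover : ∀ u : N, (∃ x : M, u = Sum.inl x) ∨ ∃ x, x ∉ S ∧ u = c x := by
    rintro (x | ⟨x, hx⟩)
    · exact Or.inl ⟨x, rfl⟩
    · exact Or.inr ⟨x, hx, (cn x hx).symm⟩
  have h1 : IsIncidenceL N := by
    refine ⟨fun u => ?_, fun u => ?_, fun u v h => ?_⟩
    · rcases cover u with ⟨x, rfl⟩ | ⟨x, -, rfl⟩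
      · exact (hM1 x).imp (simM x x).2.1.1 (simM x x).2.2.1.1
      · exact (hB1 x).imp (simB x x).2.1.1 (simB x x).2.2.1.1
    · rintro ⟨h, h'⟩
      rcases cover u with ⟨x, rfl⟩ | ⟨x, -, rfl⟩
      · exact hM2 x ⟨(simM x x).2.1.2 h, (simM x x).2.2.1.2 h'⟩
      · exact hB2 x ⟨(simB x x).2.1.2 h, (simB x x).2.2.1.2 h'⟩
    · rcases (einc _ _).1 h with ⟨x, y, rfl, rfl, hh⟩ | ⟨x, y, rfl, rfl, hh⟩
      · exact ⟨(simM x x).2.1.1 (hM3 _ _ hh).1, (simM y y).2.2.1.1 (hM3 _ _ hh).2⟩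
      · exact ⟨(simB x x).2.1.1 (hB3 _ _ hh).1, (simB y y).2.2.1.1 (hB3 _ _ hh).2⟩
  have h2 : KFreeL m n N := by
    rintro ⟨p, l, hp, hl, hpp, hll, hpl⟩
    -- everything in the image of `B` is impossible
    have allB : ¬((∀ i, ∃ x, p i = c x) ∧ ∀ j, ∃ x, l j = c x) := by
      rintro ⟨h, h'⟩
      choose p' hp' using h
      choose l' hl' using h'
      refine hBK ⟨p', l', fun i j h => hp (by rw [hp', hp', h]),
        fun i j h => hl (by rw [hl', hl', h]), fun i => ?_, fun j => ?_, fun i j => ?_⟩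
      · have := hpp i; rw [hp'] at this; exact (simB _ (p' i)).2.1.2 this
      · have := hll j; rw [hl'] at this; exact (simB _ (l' j)).2.2.1.2 this
      · have := hpl i j; rw [hp', hl'] at this; exact (simB _ _).2.2.2.2 this
    have allM : ¬((∀ i, ∃ x : M, p i = Sum.inl x) ∧ ∀ j, ∃ x : M, l j = Sum.inl x) := by
      rintro ⟨h, h'⟩
      choose p' hp' using h
      choose l' hl' using h'
      refine hMK ⟨p', l', fun i j h => hp (by rw [hp', hp', h]),
        fun i j h => hl (by rw [hl', hl', h]), fun i => ?_, fun j => ?_, fun i j => ?_⟩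
      · have := hpp i; rw [hp'] at this; exact (simM _ (p' i)).2.1.2 this
      · have := hll j; rw [hl'] at this; exact (simM _ (l' j)).2.2.1.2 this
      · have := hpl i j; rw [hp', hl'] at this; exact (simM _ _).2.2.2.2 this
    -- a new point forces all lines in `B`
    have newp : (∃ i, ∃ x, x ∉ S ∧ p i = c x) → False := by
      rintro ⟨i0, x, hx, hi0⟩
      have hlB : ∀ j, ∃ y, l j = c y ∧ incL x y := by
        intro j
        rcases (einc _ _).1 (hpl i0 j) with ⟨x', y, h, -⟩ | ⟨x', y, h, h', h''⟩
        · rw [hi0] at h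
          exact absurd (cinl _ _ h).1 hx
        · rw [hi0] at h
          cases cinj h
          exact ⟨y, h', h''⟩
      choose l' hl' hl'' using hlB
      refine allB ⟨fun i => ?_, fun j => ⟨_, hl' j⟩⟩
      by_contra hi
      have hlS : ∀ j, l' j ∈ S := by
        intro j
        rcases (einc _ _).1 (hpl i j) with ⟨x', y, -, h, -⟩ | ⟨x', y, h, -⟩
        · rw [hl'] at h
          exact (cinl _ _ h).1
        · exact absurd ⟨_, h⟩ hi
      exact hS1 x hx ⟨l', fun i j h => hl (by rw [hl', hl', h]), hlS, hl''⟩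
    have newl : (∃ i, ∃ x, x ∉ S ∧ l i = c x) → False := by
      rintro ⟨i0, x, hx, hi0⟩
      have hpB : ∀ j, ∃ y, p j = c y ∧ incL y x := by
        intro j
        rcases (einc _ _).1 (hpl j i0) with ⟨y, x', -, h, -⟩ | ⟨y, x', h', h, h''⟩
        · rw [hi0] at h
          exact absurd (cinl _ _ h).1 hx
        · rw [hi0] at h
          cases cinj h
          exact ⟨y, h', h''⟩
      choose p' hp' hp'' using hpB
      refine allB ⟨fun j => ⟨_, hp' j⟩, fun i => ?_⟩
      by_contra hi
      have hpS : ∀ j, p' j ∈ S := by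
        intro j
        rcases (einc _ _).1 (hpl j i) with ⟨y, x', h, -, -⟩ | ⟨y, x', -, h, -⟩
        · rw [hp'] at h
          exact (cinl _ _ h).1
        · exact absurd ⟨_, h⟩ hi
      exact hS2 x hx ⟨p', fun i j h => hp (by rw [hp', hp', h]), hpS, hp''⟩
    exact allM ⟨fun i => (cover (p i)).resolve_right fun h => newp ⟨i, h⟩,
      fun j => (cover (l j)).resolve_right fun h => newl ⟨j, h⟩⟩
  obtain ⟨k, ⟨e⟩⟩ := Finite.exists_equiv_fin B
  obtain ⟨ys, hys⟩ := ec_sim hM h1 h2 simM.emb k (fun i => c (e.symm i))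
    (T := S ⊕ B) (Sum.elim (fun s => Sum.inl (a s)) (fun b => Sum.inr (e b)))
  have e1 : ∀ b, (fun t => Sum.elim (⇑simM.emb) (fun i => c (e.symm i))
      (Sum.elim (fun s : S => Sum.inl (a s)) (fun b => Sum.inr (e b)) t)) (Sum.inr b) = c b := by
    intro b; simp
  refine ⟨fun b => ys (e b), fun x y => ?_, fun s => ?_⟩
  · have := hys (Sum.inr x) (Sum.inr y)
    have hx := e1 x
    have hy := e1 y
    beta_reduce at hx hy this
    rw [hx, hy] at this
    have hb := simB x y
    exact ⟨hb.1.trans this.1, hb.2.1.trans this.2.1, hb.2.2.1.trans this.2.2.1,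
      hb.2.2.2.trans this.2.2.2⟩
  · have := (hys (Sum.inr s) (Sum.inl s)).1
    have hx := e1 s
    beta_reduce at hx this
    rw [hx] at this
    exact this.1 (cS s.1 s.2)

theorem ec_good {m n : ℕ} (hm : 1 ≤ m) (hn : 1 ≤ n) {M : Type u} [IncLang.Structure M]
    (hM : IsECL m n M) : GoodL m n M where
  ne := ec_nonempty hn hM
  incd := hM.1
  free := hM.2.1
  lines := ec_lines hn hM
  points := ec_points hm hM
  ext := fun B _ _ h1 h2 S a => ec_ext hm hn hM B h1 h2 S a
universe w

section
variable {I : Type w} (U : Ultrafilter I) {M : Type u} [IncLang.Structure M]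

/-- Ultrapower. -/
abbrev UPow (U : Ultrafilter I) (M : Type u) : Type (max w u) :=
  (U : Filter I).Product (fun _ : I => M)

/-- Class of a function. -/
def ucl (x : I → M) : UPow U M := Quotient.mk _ x

variable {U}

theorem ucl_surj (x : UPow U M) : ∃ f : I → M, ucl U f = x := Quotient.exists_rep x

theorem ucl_eq (x y : I → M) : ucl U x = ucl U y ↔ ∀ᶠ i in U, x i = y i := Quotient.eq''

theorem ucl_realize [Nonempty M] {β : Type*} {k : ℕ} (φ : IncLang.BoundedFormula β k)
    (x : β → I → M) (v : Fin k → I → M) :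
    φ.Realize (fun i => ucl U (x i)) (fun i => ucl U (v i)) ↔
      ∀ᶠ a in U, φ.Realize (fun i => x i a) (fun i => v i a) :=
  Ultraproduct.boundedFormula_realize_cast (M := fun _ : I => M) (u := U) φ x v

theorem ucl_rel {k : ℕ} (r : IncLang.Relations k) (v : Fin k → I → M) :
    Structure.RelMap r (fun i => ucl U (v i)) ↔ ∀ᶠ a in U, Structure.RelMap r (fun i => v i a) := by
  apply relMap_quotient_mk'

theorem ucl_pt (x : I → M) : ptL (ucl U x) ↔ ∀ᶠ i in U, ptL (x i) := by
  have := ucl_rel (U := U) (M := M) IncRel.pt (fun _ => x)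
  simp only [relMap_pt] at this
  exact this

theorem ucl_ln (x : I → M) : lnL (ucl U x) ↔ ∀ᶠ i in U, lnL (x i) := by
  have := ucl_rel (U := U) (M := M) IncRel.lin (fun _ => x)
  simp only [relMap_lin] at this
  exact this

theorem ucl_inc (x y : I → M) : incL (ucl U x) (ucl U y) ↔ ∀ᶠ i in U, incL (x i) (y i) := by
  have := ucl_rel (U := U) (M := M) IncRel.inc ![x, y]
  simp only [relMap_inc] at this
  exact this

theorem ev_iff_const (c : Prop) (P : I → Prop) :
    (∀ᶠ i in (U : Filter I), (c ↔ P i)) ↔ (c ↔ ∀ᶠ i in (U : Filter I), P i) := by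
  by_cases h : c
  · simp [h]
  · simp only [h, false_iff]
    exact Ultrafilter.eventually_not

theorem ucl_inj {T : Type*} [Finite T] (q : T → I → M) :
    Function.Injective (fun t => ucl U (q t)) ↔
      ∀ᶠ i in (U : Filter I), Function.Injective (fun t => q t i) := by
  simp only [Function.Injective, ucl_eq, Filter.eventually_all, Ultrafilter.eventually_imp,
    Filter.eventually_const]

theorem ucl_sim {T : Type*} [Finite T] {A : Type*} [IncLang.Structure A] (p : T → A)
    (q : T → I → M) :
    Sim p (fun t => ucl U (q t)) ↔ ∀ᶠ i in (U : Filter I), Sim p (fun t => q t i) := by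
  simp only [Sim, Filter.eventually_all, Filter.eventually_and, ev_iff_const, ucl_eq, ucl_pt,
    ucl_ln, ucl_inc]

theorem good_pow {m n : ℕ} (hM : GoodL m n M) : GoodL m n (UPow U M) where
  ne := by
    obtain ⟨x⟩ := hM.ne
    exact ⟨ucl U fun _ => x⟩
  incd := by
    obtain ⟨h1, h2, h3⟩ := hM.incd
    refine ⟨fun x => ?_, fun x => ?_, fun x y => ?_⟩
    · obtain ⟨x, rfl⟩ := ucl_surj x
      rw [ucl_pt, ucl_ln, ← Ultrafilter.eventually_or]
      exact Filter.Eventually.of_forall fun i => h1 _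
    · obtain ⟨x, rfl⟩ := ucl_surj x
      rw [ucl_pt, ucl_ln, ← Filter.eventually_and, ← Ultrafilter.eventually_not]
      exact Filter.Eventually.of_forall fun i => h2 _
    · obtain ⟨x, rfl⟩ := ucl_surj x
      obtain ⟨y, rfl⟩ := ucl_surj y
      rw [ucl_pt, ucl_ln, ucl_inc, ← Filter.eventually_and]
      exact fun h => h.mono fun i => h3 _ _
  free := by
    rintro ⟨p, l, hp, hl, hpp, hll, hpl⟩
    choose p' hp' using fun i => ucl_surj (p i)
    choose l' hl' using fun i => ucl_surj (l i)
    obtain rfl : (fun i => ucl U (p' i)) = p := funext hp'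
    obtain rfl : (fun i => ucl U (l' i)) = l := funext hl'
    simp only [ucl_inj, ucl_pt, ucl_ln, ucl_inc, ← Filter.eventually_all] at hp hl hpp hll hpl
    obtain ⟨i, h1, h2, h3, h4, h5⟩ := (hp.and (hl.and (hpp.and (hll.and hpl)))).exists
    exact hM.free ⟨_, _, h1, h2, h3, h4, h5⟩
  lines := by
    intro p hp hpp
    obtain ⟨x0⟩ := hM.ne
    choose p' hp' using fun i => ucl_surj (p i)
    obtain rfl : (fun i => ucl U (p' i)) = p := funext hp'
    simp only [ucl_inj, ucl_pt, ← Filter.eventually_all] at hp hpp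
    have hex : ∀ i, ∃ b : Fin (n - 1) → M, Function.Injective (fun j => p' j i) ∧
        (∀ j, ptL (p' j i)) → Function.Injective b ∧ (∀ j, lnL (b j)) ∧
          ∀ j k, incL (p' j i) (b k) := by
      intro i
      by_cases h : Function.Injective (fun j => p' j i) ∧ (∀ j, ptL (p' j i))
      · obtain ⟨b, hb⟩ := hM.lines _ h.1 h.2
        exact ⟨b, fun _ => hb⟩
      · exact ⟨fun _ => x0, fun h' => absurd h' h⟩
    choose b hb using hex
    have hev := (hp.and hpp).mono hb
    simp only [Filter.eventually_and, Filter.eventually_all] at hev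
    refine ⟨fun j => ucl U (fun i => b i j), ?_, ?_, ?_⟩
    · rw [ucl_inj]; exact hev.1
    · intro j; rw [ucl_ln]; exact hev.2.1 j
    · intro j k; rw [ucl_inc]; exact hev.2.2 j k
  points := by
    intro p hp hpp
    obtain ⟨x0⟩ := hM.ne
    choose p' hp' using fun i => ucl_surj (p i)
    obtain rfl : (fun i => ucl U (p' i)) = p := funext hp'
    simp only [ucl_inj, ucl_ln, ← Filter.eventually_all] at hp hpp
    have hex : ∀ i, ∃ b : Fin (m - 1) → M, Function.Injective (fun j => p' j i) ∧
        (∀ j, lnL (p' j i)) → Function.Injective b ∧ (∀ j, ptL (b j)) ∧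
          ∀ k j, incL (b k) (p' j i) := by
      intro i
      by_cases h : Function.Injective (fun j => p' j i) ∧ (∀ j, lnL (p' j i))
      · obtain ⟨b, hb⟩ := hM.points _ h.1 h.2
        exact ⟨b, fun _ => hb⟩
      · exact ⟨fun _ => x0, fun h' => absurd h' h⟩
    choose b hb using hex
    have hev := (hp.and hpp).mono hb
    simp only [Filter.eventually_and, Filter.eventually_all] at hev
    refine ⟨fun j => ucl U (fun i => b i j), ?_, ?_, ?_⟩
    · rw [ucl_inj]; exact hev.1
    · intro j; rw [ucl_pt]; exact hev.2.1 j
    · intro j k; rw [ucl_inc]; exact hev.2.2 j k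
  ext := by
    intro B _ _ hB hBK S a ha hS1 hS2
    obtain ⟨x0⟩ := hM.ne
    choose a' ha' using fun i => ucl_surj (a i)
    obtain rfl : (fun i => ucl U (a' i)) = a := funext ha'
    rw [ucl_sim] at ha
    have hex : ∀ i, ∃ g : B → M, Sim (Subtype.val : S → B) (fun t => a' t i) →
        Sim id g ∧ ∀ s : S, g s = a' s i := by
      intro i
      by_cases h : Sim (Subtype.val : S → B) (fun t => a' t i)
      · obtain ⟨b, hb⟩ := hM.ext B hB hBK S _ h hS1 hS2
        exact ⟨b, fun _ => hb⟩
      · exact ⟨fun _ => x0, fun h' => absurd h' h⟩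
    choose b hb using hex
    have hev := ha.mono hb
    simp only [Filter.eventually_and, Filter.eventually_all] at hev
    refine ⟨fun j => ucl U (fun i => b i j), ?_, ?_⟩
    · rw [ucl_sim]; exact hev.1
    · intro s; rw [ucl_eq]; exact hev.2 s

theorem pow_equiv [Nonempty M] : M ≅[IncLang] UPow U M := by
  rw [elementarilyEquivalent_iff]
  intro φ
  rw [Ultraproduct.sentence_realize]
  simp

end

/-- Finite pieces of `N` can be found in `M`. -/
theorem good_local {m n : ℕ} {M : Type u} [IncLang.Structure M] {N : Type v} [IncLang.Structure N]
    (hM : GoodL m n M) (hN1 : IsIncidenceL N) (hN2 : KFreeL m n N)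
    (S : Set N) (a : S → M) (ha : Sim (Subtype.val : S → N) a)
    (hS1 : ∀ x ∉ S, ¬∃ l : Fin n → N, Function.Injective l ∧ (∀ j, l j ∈ S) ∧ ∀ j, incL x (l j))
    (hS2 : ∀ x ∉ S, ¬∃ p : Fin m → N, Function.Injective p ∧ (∀ j, p j ∈ S) ∧
      ∀ j, incL (p j) x) (F : Finset N) :
    ∃ g : N → M, Sim (Subtype.val : F → N) (fun x => g x) ∧ ∀ s : S, s.1 ∈ F → g s = a s := by
  classical
  obtain ⟨x0⟩ := hM.ne
  obtain ⟨k, ⟨e⟩⟩ := Finite.exists_equiv_fin F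
  let c : Fin k → N := fun i => (e.symm i).1
  have cinj : Function.Injective c := Subtype.val_injective.comp e.symm.injective
  let _ : IncLang.Structure (Fin k) := mkStr (fun i => ptL (c i)) (fun i => lnL (c i))
    (fun i j => incL (c i) (c j))
  have ept : ∀ i : Fin k, ptL i ↔ ptL (c i) := fun _ => Iff.rfl
  have eln : ∀ i : Fin k, lnL i ↔ lnL (c i) := fun _ => Iff.rfl
  have einc : ∀ i j : Fin k, incL i j ↔ incL (c i) (c j) := fun _ _ => Iff.rfl
  obtain ⟨g, hg1, hg2⟩ := hM.ext (Fin k)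
    ⟨fun x => hN1.1 (c x), fun x => hN1.2.1 (c x), fun x y => hN1.2.2 (c x) (c y)⟩
    (by
      rintro ⟨p, l, hp, hl, hpp, hll, hpl⟩
      exact hN2 ⟨c ∘ p, c ∘ l, cinj.comp hp, cinj.comp hl, hpp, hll, hpl⟩)
    {i | c i ∈ S} (fun i => a ⟨c i.1, i.2⟩)
    (by
      intro s t
      have := ha ⟨c s.1, s.2⟩ ⟨c t.1, t.2⟩
      exact ⟨cinj.eq_iff.symm.trans this.1, this.2⟩)
    (by
      rintro x hx ⟨l, h1, h2, h3⟩
      exact hS1 (c x) hx ⟨c ∘ l, cinj.comp h1, h2, h3⟩)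
    (by
      rintro x hx ⟨l, h1, h2, h3⟩
      exact hS2 (c x) hx ⟨c ∘ l, cinj.comp h1, h2, h3⟩)
  have hc : ∀ x (h : x ∈ F), c (e ⟨x, h⟩) = x := by intro x h; simp [c]
  refine ⟨fun x => if h : x ∈ F then g (e ⟨x, h⟩) else x0, ?_, ?_⟩
  · rintro ⟨x, hx⟩ ⟨y, hy⟩
    have := hg1 (e ⟨x, hx⟩) (e ⟨y, hy⟩)
    simp only [id, ept, eln, einc, hc, ← cinj.eq_iff] at this
    simpa only [hx, hy, dif_pos] using this
  · rintro ⟨s, hs⟩ hF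
    have hs' : c (e ⟨s, hF⟩) ∈ S := by rw [hc]; exact hs
    have := hg2 ⟨e ⟨s, hF⟩, hs'⟩
    simp only [hc] at this
    simpa only [hF, dif_pos] using this

/-- `N` embeds in an ultrapower of `M`. -/
theorem good_global {m n : ℕ} {M : Type u} [IncLang.Structure M] {N : Type v}
    [IncLang.Structure N]
    (hM : GoodL m n M) (hN1 : IsIncidenceL N) (hN2 : KFreeL m n N)
    (S : Set N) (a : S → M) (ha : Sim (Subtype.val : S → N) a)
    (hS1 : ∀ x ∉ S, ¬∃ l : Fin n → N, Function.Injective l ∧ (∀ j, l j ∈ S) ∧ ∀ j, incL x (l j))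
    (hS2 : ∀ x ∉ S, ¬∃ p : Fin m → N, Function.Injective p ∧ (∀ j, p j ∈ S) ∧
      ∀ j, incL (p j) x) :
    ∃ (U : Ultrafilter (Finset N)) (h : N ↪[IncLang] UPow U M),
      ∀ s : S, h s = ucl U (fun _ => a s) := by
  classical
  choose g hg1 hg2 using good_local hM hN1 hN2 S a ha hS1 hS2
  let U : Ultrafilter (Finset N) := Ultrafilter.of Filter.atTop
  have hU : (U : Filter (Finset N)) ≤ Filter.atTop := Ultrafilter.of_le _
  have hmem : ∀ x : N, ∀ᶠ F in (U : Filter (Finset N)), x ∈ F := fun x =>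
    hU ((Filter.eventually_ge_atTop {x}).mono fun F hF => by simpa using hF)
  have hsim : Sim (id : N → N) (fun x => ucl U (fun F => g F x)) := by
    intro x y
    have hev : ∀ᶠ F in (U : Filter (Finset N)),
        (x = y ↔ g F x = g F y) ∧ (ptL x ↔ ptL (g F x)) ∧ (lnL x ↔ lnL (g F x)) ∧
          (incL x y ↔ incL (g F x) (g F y)) := by
      filter_upwards [hmem x, hmem y] with F hx hy
      exact hg1 F ⟨x, hx⟩ ⟨y, hy⟩
    simpa only [Filter.eventually_and, ev_iff_const, ← ucl_eq, ← ucl_pt, ← ucl_ln, ← ucl_inc, id]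
      using hev
  refine ⟨U, hsim.emb, fun s => ?_⟩
  change ucl U (fun F => g F s) = _
  rw [ucl_eq]
  exact (hmem s).mono fun F hF => hg2 F s hF

theorem good_over {m n : ℕ} (hm : 1 ≤ m) (hn : 1 ≤ n) {M : Type u} [IncLang.Structure M]
    {N : Type v} [IncLang.Structure N]
    (hM : GoodL m n M) (hN1 : IsIncidenceL N) (hN2 : KFreeL m n N) (f : M ↪[IncLang] N) :
    ∃ (U : Ultrafilter (Finset N)) (h : N ↪[IncLang] UPow U M),
      ∀ x, h (f x) = ucl U (fun _ => x) := by
  obtain ⟨m, rfl⟩ : ∃ m', m = m' + 1 := ⟨m - 1, by omega⟩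
  obtain ⟨n, rfl⟩ : ∃ n', n = n' + 1 := ⟨n - 1, by omega⟩
  choose a ha using fun s : Set.range f => s.2
  obtain ⟨U, h, hh⟩ := good_global hM hN1 hN2 (Set.range f) a
    (by
      intro s t
      rw [← ha s, ← ha t, emb_pt, emb_ln, emb_inc, f.injective.eq_iff]
      simp)
    (by
      rintro x hx ⟨l, hl, hlS, hlx⟩
      choose l' hl' using hlS
      obtain rfl : (fun j => f (l' j)) = l := funext hl'
      obtain ⟨p, hp, hpp, hpl⟩ := hM.points l' (fun i j h => hl (by simp [h]))
        (fun i => (emb_ln f _).1 (hN1.2.2 _ _ (hlx i)).2)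
      refine hN2 ⟨Fin.cons x (f ∘ p), fun j => f (l' j), ?_, hl, ?_, ?_, ?_⟩
      · rw [Fin.cons_injective_iff]
        exact ⟨fun ⟨i, hi⟩ => hx ⟨_, hi⟩, f.injective.comp hp⟩
      · refine Fin.cases ?_ (fun i => ?_)
        · simpa using (hN1.2.2 _ _ (hlx 0)).1
        · simpa using (emb_pt f _).2 (hpp i)
      · exact fun i => (hN1.2.2 _ _ (hlx i)).2
      · refine Fin.cases ?_ (fun i => ?_)
        · simpa using hlx
        · simpa using fun j => (emb_inc f _ _).2 (hpl i j))
    (by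
      rintro x hx ⟨l, hl, hlS, hlx⟩
      choose l' hl' using hlS
      obtain rfl : (fun j => f (l' j)) = l := funext hl'
      obtain ⟨p, hp, hpp, hpl⟩ := hM.lines l' (fun i j h => hl (by simp [h]))
        (fun i => (emb_pt f _).1 (hN1.2.2 _ _ (hlx i)).1)
      refine hN2 ⟨fun j => f (l' j), Fin.cons x (f ∘ p), hl, ?_, ?_, ?_, fun j => ?_⟩
      · rw [Fin.cons_injective_iff]
        exact ⟨fun ⟨i, hi⟩ => hx ⟨_, hi⟩, f.injective.comp hp⟩
      · exact fun i => (hN1.2.2 _ _ (hlx i)).1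
      · refine Fin.cases ?_ (fun i => ?_)
        · simpa using (hN1.2.2 _ _ (hlx 0)).2
        · simpa using (emb_ln f _).2 (hpp i)
      · refine Fin.cases ?_ (fun i => ?_)
        · simpa using hlx j
        · simpa using (emb_inc f _ _).2 (hpl j i))
  refine ⟨U, h, fun x => ?_⟩
  have := hh ⟨f x, x, rfl⟩
  rw [f.injective (ha ⟨f x, x, rfl⟩)] at this
  exact this

/-- Model completeness. -/
theorem good_complete {m n : ℕ} (hm : 1 ≤ m) (hn : 1 ≤ n) {α : Type*} {k : ℕ}
    (φ : IncLang.BoundedFormula α k) :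
    ∀ (M N : Type u) [IncLang.Structure M] [IncLang.Structure N], GoodL m n M → GoodL m n N →
      ∀ (f : M ↪[IncLang] N) (v : α → M) (xs : Fin k → M),
        φ.Realize (f ∘ v) (f ∘ xs) ↔ φ.Realize v xs := by
  induction φ with
  | falsum => intros; rfl
  | equal t₁ t₂ =>
    intro M N _ _ _ _ f v xs
    simp only [BoundedFormula.Realize, ← Sum.comp_elim, HomClass.realize_term]
    exact f.injective.eq_iff
  | rel R ts =>
    intro M N _ _ _ _ f v xs
    simp only [BoundedFormula.Realize, ← Sum.comp_elim, HomClass.realize_term]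
    exact f.map_rel R _
  | imp φ ψ h1 h2 =>
    intro M N _ _ hM hN f v xs
    simp only [BoundedFormula.Realize, h1 M N hM hN, h2 M N hM hN]
  | all φ ih =>
    intro M N _ _ hM hN f v xs
    constructor
    · intro h x
      have := h (f x)
      rw [← Fin.comp_snoc] at this
      exact (ih M N hM hN f v _).1 this
    · intro h b
      have := hM.ne
      obtain ⟨U, g, hg⟩ := good_over hm hn hM hN.incd hN.free f
      have h1 : φ.all.Realize (fun i => ucl U (fun _ => v i)) (fun i => ucl U (fun _ => xs i)) := by
        rw [ucl_realize]
        exact Filter.Eventually.of_forall fun _ => h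
      have h2 := h1 (g b)
      rw [← ih N (UPow U M) hN (good_pow hM) g (f ∘ v) (Fin.snoc (f ∘ xs) b)]
      rw [Fin.comp_snoc]
      simpa only [Function.comp_def, hg] using h2

theorem good_equiv {m n : ℕ} (hm : 1 ≤ m) (hn : 1 ≤ n)
    (M N : Type u) [IncLang.Structure M] [IncLang.Structure N]
    (hM : GoodL m n M) (hN : GoodL m n N) : M ≅[IncLang] N := by
  have := hM.ne
  obtain ⟨U, h, -⟩ := good_global hM hN.incd hN.free ∅ (fun s => s.2.elim)
    (fun s => s.2.elim) (by rintro x - ⟨l, -, h, -⟩; exact h ⟨0, hn⟩)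
    (by rintro x - ⟨l, -, h, -⟩; exact h ⟨0, hm⟩)
  have h1 : M ≅[IncLang] UPow U M := pow_equiv
  refine h1.trans ?_
  rw [elementarilyEquivalent_iff]
  intro φ
  have := good_complete hm hn φ N (UPow U M) hN (good_pow hM) h default default
  simp only [Sentence.Realize, Formula.Realize]
  convert! this

/-- Any two existentially closed `K_{m,n}`-free incidence structures are elementarily
equivalent. -/
theorem statement_4 (m n : ℕ) (hm : 1 ≤ m) (hn : 1 ≤ n)
    (M : Type u) (N : Type v) [IncLang.Structure M] [IncLang.Structure N]
    (hM : IsECL m n M) (hN : IsECL m n N) :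
    M ≅[IncLang] N := by

  have hM' := ec_good hm hn hM
  have hN' := ec_good hm hn hN
  have := hM'.ne
  have := hN'.ne
  let U : Ultrafilter (ULift.{max u v} Unit) := pure ⟨()⟩
  have h1 : M ≅[IncLang] UPow U M := pow_equiv
  have h2 : N ≅[IncLang] UPow U N := pow_equiv
  have h3 : UPow U M ≅[IncLang] UPow U N :=
    good_equiv hm hn (UPow U M) (UPow U N) (good_pow hM') (good_pow hN')
  exact (h1.trans h3).trans h2.symm
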